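/- (Jump relations at the origin.) Write ψ_k*(λ,0) := conj(ψ_k(conj(λ),0)). For every λ ∈ ℂ with 0 < |λ| < a/3: ψ₃*(λ,0) − ψ₃(λ,0) = (iα/(3λ²))·(q̃₁(λ) − q̃₂(λ))·(q̃₁*(λ) − q̃₂*(λ)), and ψ₂*(λ,0) − ψ₂(λ,0) = (iα/(3λ²))·(q̃₁(λ) − q̃₃(λ))·(q̃₁*(λ) − q̃₃*(λ)). -/

import Mathlib

open Complex

noncomputable def ζ₁ : ℂ := 1
noncomputable def ζ₂ : ℂ := (-1 + Real.sqrt 3 * Complex.I) / 2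
noncomputable def ζ₃ : ℂ := (-1 - Real.sqrt 3 * Complex.I) / 2

/-- `sfun p z = (1/3)·(ζ₁^(−p)·e^{zζ₁} + ζ₂^(−p)·e^{zζ₂} + ζ₃^(−p)·e^{zζ₃})`. -/
noncomputable def sfun (p : ℕ) (z : ℂ) : ℂ :=
  ((ζ₁ ^ p)⁻¹ * Complex.exp (z * ζ₁) + (ζ₂ ^ p)⁻¹ * Complex.exp (z * ζ₂) +
    (ζ₃ ^ p)⁻¹ * Complex.exp (z * ζ₃)) / 3

open MeasureTheory Set

/-- q̃ for direction ζ: `∫₀^∞ e^{−iλζx} q(x) dx`. -/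
noncomputable def qt (q : ℝ → ℂ) (ζ lam : ℂ) : ℂ :=
  ∫ x in Ioi (0:ℝ), Complex.exp (-Complex.I * lam * ζ * x) * q x

/-- Autocorrelation `g_q(s) = ∫₀^∞ q(x+s) conj(q(x)) dx`. -/
noncomputable def gq (q : ℝ → ℂ) (s : ℝ) : ℂ :=
  ∫ x in Ioi (0:ℝ), q (x + s) * (starRingEnd ℂ) (q x)

/-- `m_k(λ) = ∫₀^∞ e^{−iλζ_k s} g_q(s) ds`. -/
noncomputable def mker (q : ℝ → ℂ) (ζ lam : ℂ) : ℂ :=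
  ∫ s in Ioi (0:ℝ), Complex.exp (-Complex.I * lam * ζ * s) * gq q s

/-- `f*(λ) = conj (f (conj λ))`. -/
noncomputable def starF (f : ℂ → ℂ) (lam : ℂ) : ℂ :=
  (starRingEnd ℂ) (f ((starRingEnd ℂ) lam))

/-- `m_{s₀}(λ) = (m₁(λ)+m₂(λ)+m₃(λ))/3`. -/
noncomputable def ms0 (q : ℝ → ℂ) (lam : ℂ) : ℂ :=
  (mker q ζ₁ lam + mker q ζ₂ lam + mker q ζ₃ lam) / 3

/-- `m_{s₂}(λ) = (ζ₁m₁(λ)+ζ₂m₂(λ)+ζ₃m₃(λ))/(3(iλ)²)`. -/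
noncomputable def ms2 (q : ℝ → ℂ) (lam : ℂ) : ℂ :=
  (ζ₁ * mker q ζ₁ lam + ζ₂ * mker q ζ₂ lam + ζ₃ * mker q ζ₃ lam) /
    (3 * (Complex.I * lam) ^ 2)

/-- `b(λ) = 1 + iα m_{s₂}(λ)`. -/
noncomputable def bcoef (α : ℝ) (q : ℝ → ℂ) (lam : ℂ) : ℂ :=
  1 + Complex.I * α * ms2 q lam

/-- Generic Jost solution with oscillation direction `ζk` and coefficient direction `ζc`. -/
noncomputable def jost (α : ℝ) (q : ℝ → ℂ) (ζk ζc : ℂ) (lam : ℂ) (x : ℝ) : ℂ :=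
  bcoef α q lam * Complex.exp (Complex.I * lam * ζk * x) -
    Complex.I * α * starF (qt q ζc) lam *
      ∫ t in Ioi x, sfun 2 (Complex.I * lam * ((x : ℂ) - (t : ℂ))) / (Complex.I * lam) ^ 2 * q t

/-- `ψ₁(λ,x)`. -/
noncomputable def psi1 (α : ℝ) (q : ℝ → ℂ) (lam : ℂ) (x : ℝ) : ℂ := jost α q ζ₁ ζ₁ lam x

/-- `ψ₂(λ,x)`. -/
noncomputable def psi2 (α : ℝ) (q : ℝ → ℂ) (lam : ℂ) (x : ℝ) : ℂ := jost α q ζ₂ ζ₃ lam x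

/-- `ψ₃(λ,x)`. -/
noncomputable def psi3 (α : ℝ) (q : ℝ → ℂ) (lam : ℂ) (x : ℝ) : ℂ := jost α q ζ₃ ζ₂ lam x

open scoped Convolution ComplexConjugate

/-- Splitting the total integral of a correlation into its positive and negative lags. -/
theorem integral_correlation_add (f g : ℝ → ℂ) (hf : Integrable f) (hg : Integrable g) :
    (∫ s in Ioi (0:ℝ), ∫ x, f (x + s) * g x) + (∫ s in Ioi (0:ℝ), ∫ x, g (x + s) * f x) =
      (∫ x, f x) * ∫ x, g x := by
  have hgn : Integrable (fun x => g (-x)) := hg.comp_neg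
  have hconv : (fun s => ∫ x, f (x + s) * g x) =
      ((fun x => g (-x)) ⋆[ContinuousLinearMap.mul ℂ ℂ] f) := by
    ext s
    rw [convolution_def, ← integral_neg_eq_self (fun x => f (x + s) * g x)]
    simp only [ContinuousLinearMap.mul_apply', neg_add_eq_sub, mul_comm]
  have hI : Integrable (fun s => ∫ x, f (x + s) * g x) := by
    rw [hconv]
    exact hgn.integrable_convolution _ hf
  have htot : ∫ s, ∫ x, f (x + s) * g x = (∫ x, f x) * ∫ x, g x := by
    rw [hconv, integral_convolution _ hgn hf, ContinuousLinearMap.mul_apply',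
      integral_neg_eq_self g, mul_comm]
  have hneg : ∫ s in Ioi (0:ℝ), ∫ x, g (x + s) * f x = ∫ s in Iic (0:ℝ), ∫ x, f (x + s) * g x := by
    have h := integral_comp_neg_Ioi (0:ℝ) (fun s => ∫ x, f (x + s) * g x)
    rw [neg_zero] at h
    rw [← h]
    congr 1 with s
    rw [← integral_add_right_eq_self (fun x => f (x + -s) * g x) s]
    refine integral_congr_ae (.of_forall fun x => ?_)
    simp only [add_neg_cancel_right]
    ring
  rw [hneg, ← htot, add_comm]
  exact intervalIntegral.integral_Iic_add_Ioi hI.integrableOn hI.integrableOn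

theorem setIntegral_correlation_add (f g : ℝ → ℂ) (hf : IntegrableOn f (Ioi 0))
    (hg : IntegrableOn g (Ioi 0)) :
    (∫ s in Ioi (0:ℝ), ∫ x in Ioi (0:ℝ), f (x + s) * g x) +
      (∫ s in Ioi (0:ℝ), ∫ x in Ioi (0:ℝ), g (x + s) * f x) =
      (∫ x in Ioi (0:ℝ), f x) * ∫ x in Ioi (0:ℝ), g x := by
  have key : ∀ u v : ℝ → ℂ, ∫ s in Ioi (0:ℝ), ∫ x in Ioi (0:ℝ), u (x + s) * v x =
      ∫ s in Ioi (0:ℝ), ∫ x, (Ioi (0:ℝ)).indicator u (x + s) * (Ioi (0:ℝ)).indicator v x := by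
    intro u v
    refine setIntegral_congr_fun measurableSet_Ioi fun s hs => ?_
    rw [← integral_indicator measurableSet_Ioi]
    refine integral_congr_ae (.of_forall fun x => ?_)
    by_cases hx : x ∈ Ioi (0:ℝ)
    · have : x + s ∈ Ioi (0:ℝ) := mem_Ioi.2 (add_pos (mem_Ioi.1 hx) (mem_Ioi.1 hs))
      simp only [indicator_of_mem hx, indicator_of_mem this]
    · simp only [indicator_of_notMem hx, mul_zero]
  rw [key, key, integral_correlation_add _ _ (hf.integrable_indicator measurableSet_Ioi)
    (hg.integrable_indicator measurableSet_Ioi), integral_indicator measurableSet_Ioi,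
    integral_indicator measurableSet_Ioi]

/-- Exponentially weighted square integrability controls smaller exponential weights in `L¹`. -/
theorem integrableOn_exp_mul {a : ℝ} {q : ℝ → ℂ} (hq : Measurable q)
    (hint : IntegrableOn (fun x => Real.exp (2 * a * x) * ‖q x‖ ^ 2) (Ioi 0))
    {w : ℂ} (hw : ‖w‖ < a) :
    IntegrableOn (fun x : ℝ => Complex.exp (w * x) * q x) (Ioi 0) := by
  have hexp : IntegrableOn (fun x : ℝ => Real.exp (-(2 * (a - ‖w‖)) * x)) (Ioi 0) :=
    integrableOn_exp_mul_Ioi (by linarith) 0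
  refine Integrable.mono' (hint.add hexp) (by fun_prop) ?_
  refine (ae_restrict_iff' measurableSet_Ioi).2 (.of_forall fun x (hx : 0 < x) => ?_)
  have h1 : ‖Complex.exp (w * x)‖ ≤ Real.exp (‖w‖ * x) := by
    rw [Complex.norm_exp]
    gcongr
    refine (Complex.re_le_norm _).trans ?_
    rw [norm_mul, Complex.norm_real, Real.norm_of_nonneg hx.le]
  have h2 : Real.exp (‖w‖ * x) = Real.exp (a * x) * Real.exp (-(a - ‖w‖) * x) := by
    rw [← Real.exp_add]
    ring_nf
  have h3 : Real.exp (2 * a * x) = Real.exp (a * x) ^ 2 := by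
    rw [← Real.exp_nat_mul]
    push_cast
    ring_nf
  have h4 : Real.exp (-(2 * (a - ‖w‖)) * x) = Real.exp (-(a - ‖w‖) * x) ^ 2 := by
    rw [← Real.exp_nat_mul]
    push_cast
    ring_nf
  simp only [Pi.add_apply]
  rw [norm_mul, h3, h4]
  calc ‖Complex.exp (w * x)‖ * ‖q x‖ ≤ Real.exp (‖w‖ * x) * ‖q x‖ := by gcongr
    _ ≤ _ := by
      rw [h2]
      nlinarith [sq_nonneg (Real.exp (a * x) * ‖q x‖ - Real.exp (-(a - ‖w‖) * x)),
        sq_nonneg (Real.exp (a * x) * ‖q x‖), sq_nonneg (Real.exp (-(a - ‖w‖) * x))]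

theorem starF_qt (q : ℝ → ℂ) (ζ lam : ℂ) :
    starF (qt q ζ) lam = ∫ x in Ioi (0:ℝ), Complex.exp (I * lam * conj ζ * x) * conj (q x) := by
  simp only [starF, qt]
  rw [← integral_conj]
  congr 1 with x
  simp [← Complex.exp_conj]

theorem mker_eq (q : ℝ → ℂ) (ζ lam : ℂ) :
    mker q ζ lam = ∫ s in Ioi (0:ℝ), ∫ x in Ioi (0:ℝ),
      (Complex.exp (-I * lam * ζ * ↑(x + s)) * q (x + s)) *
        (Complex.exp (I * lam * ζ * x) * conj (q x)) := by
  simp only [mker, gq]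
  congr 1 with s
  rw [← integral_const_mul]
  congr 1 with x
  have : -I * lam * ζ * s = -I * lam * ζ * ↑(x + s) + I * lam * ζ * x := by
    push_cast
    ring
  rw [this, Complex.exp_add]
  ring

theorem starF_mker_eq (q : ℝ → ℂ) (ζ lam : ℂ) :
    starF (mker q (conj ζ)) lam = ∫ s in Ioi (0:ℝ), ∫ x in Ioi (0:ℝ),
      (Complex.exp (I * lam * ζ * ↑(x + s)) * conj (q (x + s))) *
        (Complex.exp (-I * lam * ζ * x) * q x) := by
  simp only [starF, mker_eq]
  rw [← integral_conj]
  congr 1 with s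
  rw [← integral_conj]
  congr 1 with x
  simp [← Complex.exp_conj]

theorem mker_add_starF_mker {a : ℝ} {q : ℝ → ℂ} (hq : Measurable q)
    (hint : IntegrableOn (fun x => Real.exp (2 * a * x) * ‖q x‖ ^ 2) (Ioi 0))
    {ζ lam : ℂ} (hw : ‖lam‖ * ‖ζ‖ < a) :
    mker q ζ lam + starF (mker q (conj ζ)) lam = qt q ζ lam * starF (qt q (conj ζ)) lam := by
  rw [mker_eq, starF_mker_eq, starF_qt, qt, conj_conj]
  have hf := integrableOn_exp_mul (w := -I * lam * ζ) hq hint (by simpa using hw)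
  have hg := integrableOn_exp_mul (w := I * lam * ζ) (q := fun x => conj (q x))
    (by fun_prop) (by simpa using hint) (by simpa using hw)
  exact setIntegral_correlation_add _ _ hf hg

theorem conj_ζ₁ : conj ζ₁ = ζ₁ := by simp [ζ₁]

theorem conj_ζ₂ : conj ζ₂ = ζ₃ := by simp [ζ₂, ζ₃, sub_eq_add_neg, map_ofNat]

theorem conj_ζ₃ : conj ζ₃ = ζ₂ := by rw [← conj_ζ₂, conj_conj]

theorem ζ₂_add_ζ₃ : ζ₂ + ζ₃ = -1 := by
  simp only [ζ₂, ζ₃]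
  ring

theorem ζ₂_mul_ζ₃ : ζ₂ * ζ₃ = 1 := by
  have h : ((Real.sqrt 3 : ℝ) : ℂ) ^ 2 = 3 := by
    rw [← Complex.ofReal_pow, Real.sq_sqrt (by norm_num)]
    norm_num
  simp only [ζ₂, ζ₃]
  linear_combination (-(1:ℂ) / 4) * I ^ 2 * h - (3 / 4 : ℂ) * Complex.I_sq

theorem inv_ζ₂_sq : (ζ₂ ^ 2)⁻¹ = ζ₂ := by
  refine inv_eq_of_mul_eq_one_left ?_
  linear_combination (ζ₂ ^ 2 - ζ₂) * ζ₂_add_ζ₃ - (ζ₂ - 1) * ζ₂_mul_ζ₃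

theorem inv_ζ₃_sq : (ζ₃ ^ 2)⁻¹ = ζ₃ := by
  rw [← conj_ζ₂, ← map_pow, ← map_inv₀, inv_ζ₂_sq]

theorem norm_ζ₂ : ‖ζ₂‖ = 1 := by
  have h : ‖ζ₂‖ * ‖ζ₂‖ = 1 := by
    calc ‖ζ₂‖ * ‖ζ₂‖ = ‖ζ₂ * ζ₃‖ := by rw [← conj_ζ₂, norm_mul, Complex.norm_conj]
      _ = 1 := by simp [ζ₂_mul_ζ₃]
  nlinarith [norm_nonneg ζ₂]

theorem norm_ζ₃ : ‖ζ₃‖ = 1 := by rw [← conj_ζ₂, Complex.norm_conj, norm_ζ₂]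

theorem norm_ζ₁ : ‖ζ₁‖ = 1 := by simp [ζ₁]

theorem jost_zero {a : ℝ} {q : ℝ → ℂ} (hq : Measurable q)
    (hint : IntegrableOn (fun x => Real.exp (2 * a * x) * ‖q x‖ ^ 2) (Ioi 0)) (α : ℝ)
    (ζk ζc : ℂ) {lam : ℂ} (hlam : ‖lam‖ < a) :
    jost α q ζk ζc lam 0 = bcoef α q lam + I * α / (3 * lam ^ 2) * starF (qt q ζc) lam *
      (qt q ζ₁ lam + ζ₂ * qt q ζ₂ lam + ζ₃ * qt q ζ₃ lam) := by
  have hi : ∀ ζ : ℂ, ‖ζ‖ = 1 →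
      IntegrableOn (fun x : ℝ => Complex.exp (-I * lam * ζ * x) * q x) (Ioi 0) := fun ζ hζ =>
    integrableOn_exp_mul hq hint (by simpa [hζ] using hlam)
  have hsum : ∫ t in Ioi (0:ℝ),
      sfun 2 (I * lam * (((0:ℝ) : ℂ) - (t : ℂ))) / (I * lam) ^ 2 * q t =
      (qt q ζ₁ lam + ζ₂ * qt q ζ₂ lam + ζ₃ * qt q ζ₃ lam) / (3 * (I * lam) ^ 2) := by
    have h12 : IntegrableOn (fun x : ℝ => Complex.exp (-I * lam * ζ₁ * x) * q x +
        ζ₂ * (Complex.exp (-I * lam * ζ₂ * x) * q x)) (Ioi 0) :=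
      (hi _ norm_ζ₁).add ((hi _ norm_ζ₂).const_mul _)
    simp only [qt]
    rw [← integral_const_mul, ← integral_const_mul, ← integral_add (hi _ norm_ζ₁)
      ((hi _ norm_ζ₂).const_mul _), ← integral_add h12 ((hi _ norm_ζ₃).const_mul _),
      ← integral_div]
    congr 1 with t
    have he : ∀ ζ : ℂ, I * lam * (((0:ℝ) : ℂ) - (t : ℂ)) * ζ = -I * lam * ζ * t := fun ζ => by
      push_cast
      ring
    have h1 : (ζ₁ ^ 2)⁻¹ = 1 := by simp [ζ₁]
    simp only [sfun, inv_ζ₂_sq, inv_ζ₃_sq, h1, he]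
    ring
  rw [jost, hsum, mul_pow, I_sq]
  simp only [ofReal_zero, mul_zero, Complex.exp_zero, mul_one]
  ring

theorem starF_jost_zero {a : ℝ} {q : ℝ → ℂ} (hq : Measurable q)
    (hint : IntegrableOn (fun x => Real.exp (2 * a * x) * ‖q x‖ ^ 2) (Ioi 0)) (α : ℝ)
    (ζk ζc : ℂ) {lam : ℂ} (hlam : ‖lam‖ < a) :
    starF (fun μ => jost α q ζk ζc μ 0) lam =
      starF (bcoef α q) lam - I * α / (3 * lam ^ 2) * qt q ζc lam *
      (starF (qt q ζ₁) lam + ζ₃ * starF (qt q ζ₂) lam + ζ₂ * starF (qt q ζ₃) lam) := by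
  simp only [starF]
  rw [jost_zero hq hint α ζk ζc (lam := conj lam) (by simpa using hlam)]
  simp only [starF, map_add, map_mul, map_div₀, map_pow, conj_conj, conj_I, conj_ofReal,
    conj_ζ₂, conj_ζ₃, map_ofNat]
  ring

theorem starF_bcoef_sub {a : ℝ} {q : ℝ → ℂ} (hq : Measurable q)
    (hint : IntegrableOn (fun x => Real.exp (2 * a * x) * ‖q x‖ ^ 2) (Ioi 0)) (α : ℝ)
    {lam : ℂ} (hlam : ‖lam‖ < a) :
    starF (bcoef α q) lam - bcoef α q lam = I * α / (3 * lam ^ 2) *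
      (qt q ζ₁ lam * starF (qt q ζ₁) lam + ζ₂ * (qt q ζ₂ lam * starF (qt q ζ₃) lam) +
        ζ₃ * (qt q ζ₃ lam * starF (qt q ζ₂) lam)) := by
  have h1 := mker_add_starF_mker (ζ := ζ₁) (lam := lam) hq hint (by simpa [norm_ζ₁] using hlam)
  have h2 := mker_add_starF_mker (ζ := ζ₂) (lam := lam) hq hint (by simpa [norm_ζ₂] using hlam)
  have h3 := mker_add_starF_mker (ζ := ζ₃) (lam := lam) hq hint (by simpa [norm_ζ₃] using hlam)
  rw [conj_ζ₁] at h1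
  rw [conj_ζ₂] at h2
  rw [conj_ζ₃] at h3
  rw [← h1, ← h2, ← h3]
  simp only [starF, bcoef, ms2, mul_pow, I_sq, map_add, map_one, map_mul, map_div₀, map_pow,
    map_neg, conj_conj, conj_I, conj_ofReal, conj_ζ₁, conj_ζ₂, conj_ζ₃, map_ofNat]
  rw [show ζ₁ = 1 from rfl]
  ring

theorem stmt18 (a : ℝ) (ha : 0 < a) (α : ℝ) (q : ℝ → ℂ) (hq : Measurable q)
    (hint : IntegrableOn (fun x => Real.exp (2 * a * x) * ‖q x‖ ^ 2) (Ioi 0))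
    (lam : ℂ) (h0 : lam ≠ 0) (hlam : ‖lam‖ < a / 3) :
    starF (fun μ => psi3 α q μ 0) lam - psi3 α q lam 0 =
      (Complex.I * α / (3 * lam ^ 2)) * (qt q ζ₁ lam - qt q ζ₂ lam) *
        (starF (qt q ζ₁) lam - starF (qt q ζ₂) lam) ∧
    starF (fun μ => psi2 α q μ 0) lam - psi2 α q lam 0 =
      (Complex.I * α / (3 * lam ^ 2)) * (qt q ζ₁ lam - qt q ζ₃ lam) *
        (starF (qt q ζ₁) lam - starF (qt q ζ₃) lam) := by
  have hlam' : ‖lam‖ < a := by linarith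
  have hb := starF_bcoef_sub hq hint α hlam'
  refine ⟨?_, ?_⟩
  · simp only [psi3]
    rw [starF_jost_zero hq hint α _ _ hlam', jost_zero hq hint α _ _ hlam']
    linear_combination hb - I * α / (3 * lam ^ 2) * qt q ζ₂ lam * starF (qt q ζ₂) lam * ζ₂_add_ζ₃
  · simp only [psi2]
    rw [starF_jost_zero hq hint α _ _ hlam', jost_zero hq hint α _ _ hlam']
    linear_combination hb - I * α / (3 * lam ^ 2) * qt q ζ₃ lam * starF (qt q ζ₃) lam * ζ₂_add_ζ₃
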